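/- Let Q_1', A, B be homogeneous quadratic polynomials and b_2, b homogeneous linear forms, all in the variables x_2, …, x_n (i.e., not involving x_1), and set Q_1 = x_1² + Q_1', Q_2 = x_1·b_2 − A, and Q = x_1·b + B in ℂ[x_1, …, x_n]. Assume Q vanishes at every point of ℂⁿ where both Q_1 and Q_2 vanish, that b_2 ≠ 0, and that b_2 divides A in ℂ[x_2, …, x_n]. Then at least one of the following holds: (1) Q lies in the ℂ-linear span of Q_1 and Q_2; (2) there exist α, β ∈ ℂ, not both zero, and a linear form ℓ such that α·Q_1 + β·Q_2 = ℓ²; (3) there exist linear forms c_1 and c_2 such that each of Q, Q_1, Q_2 vanishes at every point a ∈ ℂⁿ with c_1(a) = c_2(a) = 0. -/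

import Mathlib

open MvPolynomial

theorem MvPolynomial.IsHomogeneous.exists_eq_mul_of_dvd {σ R : Type*} [CommRing R] {m k : ℕ}
    {p q : MvPolynomial σ R} (hp : p.IsHomogeneous m) (hq : q.IsHomogeneous (m + k))
    (h : p ∣ q) : ∃ r : MvPolynomial σ R, r.IsHomogeneous k ∧ q = p * r := by
  obtain ⟨r, rfl⟩ := h
  let _ := MvPolynomial.gradedAlgebra (σ := σ) (R := R)
  refine ⟨DirectSum.decompose (homogeneousSubmodule σ R) r k,
    (DirectSum.decompose (homogeneousSubmodule σ R) r k).2, ?_⟩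
  rw [← DirectSum.coe_decompose_mul_add_of_left_mem (homogeneousSubmodule σ R)
    (i := m) (j := k) hp]
  exact (DirectSum.decompose_of_mem_same _ hq).symm

theorem MvPolynomial.IsHomogeneous.prime_of_ne_zero {σ K : Type*} [Field K]
    {p : MvPolynomial σ K} (hp : p.IsHomogeneous 1) (h0 : p ≠ 0) : Prime p := by
  refine (irreducible_of_totalDegree_eq_one (hp.totalDegree h0) fun x hx => ?_).prime
  rw [isUnit_iff_ne_zero]
  rintro rfl
  exact h0 (MvPolynomial.ext _ _ fun i => by simpa using hx i)

theorem MvPolynomial.notMem_vars_of_notMem_vars_mul {σ R : Type*} [CommRing R] [IsDomain R]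
    {i : σ} {p q : MvPolynomial σ R} (hp : p ≠ 0) (h : i ∉ (p * q).vars) : i ∉ q.vars := by
  classical
  rcases eq_or_ne q 0 with rfl | hq
  · simp
  have key : ∀ f : MvPolynomial σ R, i ∉ f.vars ↔ degreeOf i f = 0 := fun f => by
    rw [vars_def, degreeOf_def, Multiset.mem_toFinset, Multiset.count_eq_zero]
  rw [key, degreeOf_mul_eq hp hq] at h
  rw [key]
  omega

theorem MvPolynomial.eval_update_of_notMem_vars {σ R : Type*} [CommSemiring R] [DecidableEq σ]
    {i : σ} {p : MvPolynomial σ R} (h : i ∉ p.vars) (a : σ → R) (t : R) :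
    eval (Function.update a i t) p = eval a p := by
  refine eval₂Hom_congr' rfl (fun j hj _ => ?_) rfl
  exact Function.update_of_ne (ne_of_mem_of_not_mem hj h) _ _

/-- Hilbert's Nullstellensatz for a hypersurface. -/
theorem MvPolynomial.exists_dvd_pow_of_eval_eq_zero {σ K : Type*} [Finite σ] [Field K]
    [IsAlgClosed K] {f g : MvPolynomial σ K} (h : ∀ a, eval a f = 0 → eval a g = 0) :
    ∃ N : ℕ, f ∣ g ^ N := by
  have hg : g ∈ vanishingIdeal K (zeroLocus K (Ideal.span {f})) := by
    intro a ha
    simpa [aeval_eq_eval] using h a (by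
      simpa [aeval_eq_eval] using ha f (Ideal.mem_span_singleton_self f))
  rw [vanishingIdeal_zeroLocus_eq_radical] at hg
  obtain ⟨N, hN⟩ := hg
  exact ⟨N, Ideal.mem_span_singleton.mp hN⟩

/-- If a nonunit divides a power of a product of two primes, one of the primes divides it. -/
theorem Prime.dvd_or_dvd_of_dvd_mul_pow {R : Type*} [CommRing R] [IsDomain R]
    [UniqueFactorizationMonoid R] {p q r : R} (hp : Prime p) (hq : Prime q)
    (hr : ¬ IsUnit r) {N : ℕ} (h : r ∣ (p * q) ^ N) : p ∣ r ∨ q ∣ r := by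
  have hr0 : r ≠ 0 := by
    rintro rfl
    exact pow_ne_zero N (mul_ne_zero hp.ne_zero hq.ne_zero) (zero_dvd_iff.mp h)
  obtain ⟨f, hf, hfr⟩ := WfDvdMonoid.exists_irreducible_factor hr hr0
  rcases hf.prime.dvd_or_dvd (hf.prime.dvd_of_dvd_pow (hfr.trans h)) with hd | hd
  · exact Or.inl ((hf.associated_of_dvd hp.irreducible hd).symm.dvd.trans hfr)
  · exact Or.inr ((hf.associated_of_dvd hq.irreducible hd).symm.dvd.trans hfr)

/-- Let `Q1', A, B` be homogeneous quadratics and `b2, b` linear forms, none involving the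
variable `x_0`, and set `Q1 = x_0² + Q1'`, `Q2 = x_0·b2 − A`, `Q = x_0·b + B`. Assume `Q`
vanishes on the common zero set of `Q1` and `Q2`, that `b2 ≠ 0` and that `b2` divides `A`.
Then either `Q ∈ span{Q1, Q2}`, or some nontrivial linear combination `α Q1 + β Q2` is the
square of a linear form, or there are two linear forms `c1, c2` such that `Q, Q1, Q2` all
vanish on the common zero set of `c1, c2`. -/
theorem stmt_10 (n : ℕ) (Q1' A B b2 b Q1 Q2 Q : MvPolynomial (Fin (n + 1)) ℂ)
    (hQ1' : Q1'.IsHomogeneous 2) (hA : A.IsHomogeneous 2) (hB : B.IsHomogeneous 2)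
    (hb2 : b2.IsHomogeneous 1) (hb : b.IsHomogeneous 1)
    (hvQ1' : (0 : Fin (n + 1)) ∉ Q1'.vars) (hvA : (0 : Fin (n + 1)) ∉ A.vars)
    (hvB : (0 : Fin (n + 1)) ∉ B.vars) (hvb2 : (0 : Fin (n + 1)) ∉ b2.vars)
    (hvb : (0 : Fin (n + 1)) ∉ b.vars)
    (hQ1 : Q1 = X 0 ^ 2 + Q1') (hQ2 : Q2 = X 0 * b2 - A) (hQ : Q = X 0 * b + B)
    (hvan : ∀ a : Fin (n + 1) → ℂ, eval a Q1 = 0 → eval a Q2 = 0 → eval a Q = 0)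
    (hb2ne : b2 ≠ 0) (hdvd : b2 ∣ A) :
    Q ∈ Submodule.span ℂ ({Q1, Q2} : Set (MvPolynomial (Fin (n + 1)) ℂ)) ∨
    (∃ (α β : ℂ) (ℓ : MvPolynomial (Fin (n + 1)) ℂ), (α ≠ 0 ∨ β ≠ 0) ∧
      ℓ.IsHomogeneous 1 ∧ α • Q1 + β • Q2 = ℓ ^ 2) ∨
    (∃ c1 c2 : MvPolynomial (Fin (n + 1)) ℂ, c1.IsHomogeneous 1 ∧ c2.IsHomogeneous 1 ∧
      ∀ a : Fin (n + 1) → ℂ, eval a c1 = 0 → eval a c2 = 0 →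
        eval a Q = 0 ∧ eval a Q1 = 0 ∧ eval a Q2 = 0) := by
  have hp2 : Prime b2 := hb2.prime_of_ne_zero hb2ne
  have hX : (X 0 : MvPolynomial (Fin (n + 1)) ℂ).IsHomogeneous 1 := isHomogeneous_X _ _
  suffices Q ∈ Submodule.span ℂ ({Q1, Q2} : Set (MvPolynomial (Fin (n + 1)) ℂ)) ∨
      ∃ c1 c2 : MvPolynomial (Fin (n + 1)) ℂ, c1.IsHomogeneous 1 ∧ c2.IsHomogeneous 1 ∧
        ∀ a : Fin (n + 1) → ℂ, eval a c1 = 0 → eval a c2 = 0 →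
          eval a Q1 = 0 ∧ eval a Q2 = 0 by
    refine this.imp_right fun ⟨c1, c2, h1, h2, h⟩ => Or.inr ⟨c1, c2, h1, h2, fun a ha1 ha2 => ?_⟩
    obtain ⟨hz1, hz2⟩ := h a ha1 ha2
    exact ⟨hvan a hz1 hz2, hz1, hz2⟩
  obtain ⟨l, hl, rfl⟩ := hb2.exists_eq_mul_of_dvd (k := 1) hA hdvd
  have hvl := notMem_vars_of_notMem_vars_mul hb2ne hvA
  subst hQ1 hQ2 hQ
  by_cases hdQ : b2 ∣ Q1'
  · obtain ⟨m, rfl⟩ := hdQ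
    refine Or.inr ⟨X 0, b2, hX, hb2, fun a h1 h2 => ?_⟩
    simp only [eval_X] at h1
    simp [h1, h2]
  have hvan' : ∀ a, eval a b2 = 0 → eval a B = 0 ∧ eval a (b * Q1') = 0 := by
    intro a ha
    obtain ⟨s, hs⟩ := IsAlgClosed.exists_pow_nat_eq (-eval a Q1') two_pos
    have key : ∀ t : ℂ, t ^ 2 = -eval a Q1' → t * eval a b + eval a B = 0 := by
      intro t ht
      simpa [eval_update_of_notMem_vars, hvQ1', hvb2, hvb, hvB, hvl, ha, ht] using
        hvan (Function.update a 0 t)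
    have h1 := key s hs
    have h2 := key (-s) (by rw [neg_sq, hs])
    refine ⟨by linear_combination (h1 + h2) / 2, ?_⟩
    rw [eval_mul]
    linear_combination (-s) * (h1 - h2) / 2 + eval a b * hs
  have hdB : b2 ∣ B := by
    obtain ⟨N, hN⟩ := exists_dvd_pow_of_eval_eq_zero fun a ha => (hvan' a ha).1
    exact hp2.dvd_of_dvd_pow hN
  have hdb : b2 ∣ b := by
    obtain ⟨N, hN⟩ := exists_dvd_pow_of_eval_eq_zero fun a ha => (hvan' a ha).2
    exact (hp2.dvd_or_dvd (hp2.dvd_of_dvd_pow hN)).resolve_right hdQ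
  obtain ⟨k, hk, rfl⟩ := hb2.exists_eq_mul_of_dvd (k := 1) hB hdB
  obtain ⟨c, hc, rfl⟩ := hb2.exists_eq_mul_of_dvd (k := 0) hb hdb
  obtain ⟨β, rfl⟩ : ∃ β, c = C β :=
    ⟨_, totalDegree_eq_zero_iff_eq_C.mp (Nat.le_zero.mp hc.totalDegree_le)⟩
  have hm : (C β * l + k).IsHomogeneous 1 := (hl.C_mul β).add hk
  rcases eq_or_ne (C β * l + k) 0 with hm0 | hm0
  · left
    rw [Submodule.mem_span_pair]
    refine ⟨0, β, ?_⟩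
    rw [smul_eq_C_mul, smul_eq_C_mul, C_0]
    linear_combination (-b2) * hm0
  right
  set R := l ^ 2 + Q1' with hR
  have hvanR : ∀ a, eval a R = 0 → eval a (b2 * (C β * l + k)) = 0 := by
    intro a ha
    have h := hvan (Function.update a 0 (eval a l))
    simp only [eval_add, eval_sub, eval_mul, eval_pow, eval_X, eval_C, Function.update_self,
      eval_update_of_notMem_vars, hvQ1', hvb2, hvl, hR,
      notMem_vars_of_notMem_vars_mul hb2ne hvB, not_false_eq_true] at h ha ⊢
    linear_combination h ha (by ring)
  have hRu : ¬ IsUnit R := by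
    intro hu
    have h0 : eval 0 R = 0 := by
      have hz : ∀ p : MvPolynomial (Fin (n + 1)) ℂ, p.IsHomogeneous 2 → eval 0 p = 0 :=
        fun p hp => by
          rw [eval_zero, constantCoeff_eq]
          exact hp.coeff_eq_zero (by simp)
      exact hz R ((hl.pow 2).add hQ1')
    exact (hu.map (eval 0)).ne_zero h0
  obtain ⟨N, hN⟩ := exists_dvd_pow_of_eval_eq_zero hvanR
  have hX0 : ∀ a : Fin (n + 1) → ℂ, eval a (X 0 - l) = 0 → a 0 = eval a l := fun a ha => by
    simpa [sub_eq_zero] using ha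
  suffices ∃ d : MvPolynomial (Fin (n + 1)) ℂ, d.IsHomogeneous 1 ∧ d ∣ R by
    obtain ⟨d, hd, e, he⟩ := this
    refine ⟨d, X 0 - l, hd, hX.sub hl, fun a h1 h2 => ?_⟩
    have hQ := congrArg (eval a) (hR.symm.trans he)
    simp only [eval_add, eval_mul, eval_pow, h1, zero_mul] at hQ
    constructor
    · simpa [hX0 a h2] using hQ
    · simp only [eval_sub, eval_mul, eval_X, hX0 a h2]
      ring
  rcases hp2.dvd_or_dvd_of_dvd_mul_pow (hm.prime_of_ne_zero hm0) hRu hN with hd | hd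
  exacts [⟨_, hb2, hd⟩, ⟨_, hm, hd⟩]
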